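/- There is a constant C such that for all sufficiently smooth u, v on the torus O, ||∇ b(u,v)||_{L^2} ≤ C min( ||u||_{H^3} ||v||_{H^2}, ||u||_{H^2} ||v||_{H^3} ), where b(u,v) = (u·∇_2)v − (∫_{-h}^z div_2 u dξ) ∂_z v. -/

import Mathlib

open MeasureTheory intervalIntegral

/-- The fundamental domain of the torus `O = T_L² × T_h`. -/
def torusBox (L h : ℝ) : Set (ℝ × ℝ × ℝ) :=
  Set.Icc (0:ℝ) L ×ˢ Set.Icc (0:ℝ) L ×ˢ Set.Icc (-h) (0:ℝ)

/-- Periodicity on the torus. -/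
def torusPeriodic (L h : ℝ) (v : ℝ × ℝ × ℝ → ℝ × ℝ) : Prop :=
  (∀ ζ : ℝ × ℝ × ℝ, v (ζ.1 + L, ζ.2.1, ζ.2.2) = v ζ) ∧
  (∀ ζ : ℝ × ℝ × ℝ, v (ζ.1, ζ.2.1 + L, ζ.2.2) = v ζ) ∧
  (∀ ζ : ℝ × ℝ × ℝ, v (ζ.1, ζ.2.1, ζ.2.2 + h) = v ζ)

/-- Horizontal divergence. -/
noncomputable def div2' (u : ℝ × ℝ × ℝ → ℝ × ℝ) (ζ : ℝ × ℝ × ℝ) : ℝ :=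
  (fderiv ℝ u ζ (1, 0, 0)).1 + (fderiv ℝ u ζ (0, 1, 0)).2

/-- The primitive-equations nonlinearity
`b(u,v) = (u·∇₂)v − (∫_{-h}^z div₂ u dξ) ∂_z v`. -/
noncomputable def bPE' (h : ℝ) (u v : ℝ × ℝ × ℝ → ℝ × ℝ) (ζ : ℝ × ℝ × ℝ) : ℝ × ℝ :=
  (u ζ).1 • fderiv ℝ v ζ (1, 0, 0) + (u ζ).2 • fderiv ℝ v ζ (0, 1, 0)
    - (∫ ξ in (-h)..ζ.2.2, div2' u (ζ.1, ζ.2.1, ξ)) • fderiv ℝ v ζ (0, 0, 1)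

/-- `L²(O)` norm. -/
noncomputable def l2Norm {α : Type*} [NormedAddCommGroup α]
    (L h : ℝ) (f : ℝ × ℝ × ℝ → α) : ℝ :=
  (∫ ζ in torusBox L h, ‖f ζ‖ ^ 2) ^ (1/2 : ℝ)

/-- Sobolev `H^j(O)` norm. -/
noncomputable def sobNorm (L h : ℝ) (j : ℕ) (v : ℝ × ℝ × ℝ → ℝ × ℝ) : ℝ :=
  (∑ i ∈ Finset.range (j + 1),
      ∫ ζ in torusBox L h, ‖iteratedFDeriv ℝ i v ζ‖ ^ 2) ^ (1/2 : ℝ)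


theorem volHaar : (volume : Measure (ℝ × ℝ × ℝ)).IsAddHaarMeasure := by
  have : (volume : Measure (ℝ × ℝ)).IsAddHaarMeasure :=
    Measure.prod.instIsAddHaarMeasure (volume : Measure ℝ) (volume : Measure ℝ)
  exact Measure.prod.instIsAddHaarMeasure (volume : Measure ℝ) (volume : Measure (ℝ × ℝ))

theorem holder4 {α : Type*} [MeasurableSpace α] (μ : Measure α) {f g : α → ENNReal}
    (hf : Measurable f) (hg : Measurable g) :
    (∫⁻ a, f a * g a ∂μ) ^ 4 ≤ (∫⁻ a, f a ^ (4/3 : ℝ) ∂μ) ^ 3 * ∫⁻ a, g a ^ 4 ∂μ := by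
  have hpq : (4/3 : ℝ).HolderConjugate 4 := by
    rw [Real.holderConjugate_iff]; norm_num
  have h := ENNReal.lintegral_mul_le_Lp_mul_Lq μ hpq hf.aemeasurable hg.aemeasurable
  have h2 := pow_le_pow_left' h 4
  refine h2.trans (le_of_eq ?_)
  rw [mul_pow]
  congr 1
  · rw [← ENNReal.rpow_natCast, ← ENNReal.rpow_natCast, ← ENNReal.rpow_mul]
    norm_num
  · rw [← ENNReal.rpow_natCast, ← ENNReal.rpow_mul]
    norm_num

theorem holder2 {α : Type*} [MeasurableSpace α] (μ : Measure α) {f g : α → ENNReal}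
    (hf : Measurable f) (hg : Measurable g) :
    (∫⁻ a, f a * g a ∂μ) ^ 2 ≤ (∫⁻ a, f a ^ 2 ∂μ) * ∫⁻ a, g a ^ 2 ∂μ := by
  have hpq : (2 : ℝ).HolderConjugate 2 := by
    rw [Real.holderConjugate_iff]; norm_num
  have h := ENNReal.lintegral_mul_le_Lp_mul_Lq μ hpq hf.aemeasurable hg.aemeasurable
  have h2 := pow_le_pow_left' h 2
  refine h2.trans (le_of_eq ?_)
  rw [mul_pow]
  congr 1
  · rw [← ENNReal.rpow_natCast, ← ENNReal.rpow_mul]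
    norm_num
  · rw [← ENNReal.rpow_natCast, ← ENNReal.rpow_mul]
    norm_num

theorem holder4_one {α : Type*} [MeasurableSpace α] (μ : Measure α) {g : α → ENNReal}
    (hg : Measurable g) :
    (∫⁻ a, g a ∂μ) ^ 4 ≤ (μ Set.univ) ^ 3 * ∫⁻ a, g a ^ 4 ∂μ := by
  have := holder4 μ (f := fun _ => 1) measurable_const hg
  simpa using this

theorem holder2_one {α : Type*} [MeasurableSpace α] (μ : Measure α) {g : α → ENNReal}
    (hg : Measurable g) :
    (∫⁻ a, g a ∂μ) ^ 2 ≤ (μ Set.univ) * ∫⁻ a, g a ^ 2 ∂μ := by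
  have := holder2 μ (f := fun _ => 1) measurable_const hg
  simpa using this

theorem lint_rpow_fin (r : ℝ) (hr : -1 < r) :
    ∫⁻ t in Set.Ioo (0:ℝ) 1, ENNReal.ofReal (t ^ r) ≠ ⊤ := by
  have h := (intervalIntegral.intervalIntegrable_rpow' (a := 0) (b := 1) hr)
  rw [intervalIntegrable_iff_integrableOn_Ioo_of_le zero_le_one] at h
  have h2 := h.2
  rw [hasFiniteIntegral_iff_enorm] at h2
  refine ne_of_lt (lt_of_le_of_lt ?_ h2)
  exact lintegral_mono fun t => Real.ofReal_le_enorm _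

theorem weight4 : ∃ c : ENNReal, c ≠ ⊤ ∧ ∀ T : ℝ → ENNReal, Measurable T →
    (∫⁻ t in Set.Ioo (0:ℝ) 1, T t) ^ 4 ≤
      c * ∫⁻ t in Set.Ioo (0:ℝ) 1, ENNReal.ofReal (t ^ (5/2 : ℝ)) * T t ^ 4 := by
  refine ⟨(∫⁻ t in Set.Ioo (0:ℝ) 1, ENNReal.ofReal (t ^ (-5/6 : ℝ))) ^ 3,
    ENNReal.pow_ne_top (lint_rpow_fin _ (by norm_num)), fun T hT => ?_⟩
  have h := holder4 (volume.restrict (Set.Ioo (0:ℝ) 1))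
    (f := fun t => ENNReal.ofReal (t ^ (-5/8 : ℝ)))
    (g := fun t => ENNReal.ofReal (t ^ (5/8 : ℝ)) * T t) (by fun_prop) (by fun_prop)
  convert h using 2
  · refine setLIntegral_congr_fun measurableSet_Ioo fun t ht => ?_
    rw [← mul_assoc, ← ENNReal.ofReal_mul (Real.rpow_nonneg ht.1.le _), ← Real.rpow_add ht.1]
    norm_num
  · congr 1
    refine setLIntegral_congr_fun measurableSet_Ioo fun t ht => ?_
    rw [ENNReal.ofReal_rpow_of_pos (Real.rpow_pos_of_pos ht.1 _), ← Real.rpow_mul ht.1.le]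
    norm_num
  · refine setLIntegral_congr_fun measurableSet_Ioo fun t ht => ?_
    rw [mul_pow, ← ENNReal.ofReal_pow (Real.rpow_nonneg ht.1.le _), ← Real.rpow_natCast,
      ← Real.rpow_mul ht.1.le]
    norm_num

theorem lint_scale {Q : Set (ℝ × ℝ × ℝ)} (hQ : Convex ℝ Q) (hm : MeasurableSet Q)
    (g : ℝ × ℝ × ℝ → ENNReal) {x : ℝ × ℝ × ℝ} (hx : x ∈ Q) {t : ℝ} (ht : 0 < t) (ht1 : t ≤ 1) :
    ENNReal.ofReal (t ^ 3) * ∫⁻ y in Q, g (x + t • (y - x)) ≤ ∫⁻ y in Q, g y := by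
  have := volHaar
  have h := lintegral_image_eq_lintegral_abs_det_fderiv_mul (volume : Measure (ℝ × ℝ × ℝ)) hm
    (f := fun y => x + t • (y - x)) (f' := fun _ => t • ContinuousLinearMap.id ℝ _)
    (fun y _ => by
      have : HasFDerivAt (fun y : ℝ × ℝ × ℝ => x + t • (y - x))
        (t • ContinuousLinearMap.id ℝ _) y :=
        (((hasFDerivAt_id y).sub_const x).const_smul t).const_add x
      exact this.hasFDerivWithinAt)
    (fun a _ b _ hab => by
      have h2 : t • (a - x) = t • (b - x) := by simpa using hab
      have h3 := smul_right_injective _ ht.ne' h2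
      simpa using h3) g
  have hdet : |(t • ContinuousLinearMap.id ℝ (ℝ × ℝ × ℝ)).det| = t ^ 3 := by
    rw [ContinuousLinearMap.det]
    simp [LinearMap.det_smul, abs_of_pos ht]
  simp only [hdet] at h
  rw [lintegral_const_mul' _ _ ENNReal.ofReal_ne_top] at h
  rw [← h]
  refine lintegral_mono_set ?_
  rintro _ ⟨y, hy, rfl⟩
  exact hQ.add_smul_sub_mem hx hy ⟨ht.le, ht1⟩

theorem repr_bound {F : Type*} [NormedAddCommGroup F] [NormedSpace ℝ F] [CompleteSpace F]
    {Q : Set (ℝ × ℝ × ℝ)} (hm : MeasurableSet Q) {R : ℝ}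
    (hR : ∀ x ∈ Q, ∀ y ∈ Q, ‖y - x‖ ≤ R) {f : ℝ × ℝ × ℝ → F} (hf : ContDiff ℝ 1 f)
    {x : ℝ × ℝ × ℝ} (hx : x ∈ Q) :
    ‖f x‖ₑ * volume Q ≤ (∫⁻ y in Q, ‖f y‖ₑ) + ENNReal.ofReal R *
      ∫⁻ t in Set.Ioo (0:ℝ) 1, ∫⁻ y in Q, ‖fderiv ℝ f (x + t • (y - x))‖ₑ := by
  have hcd : Continuous (fderiv ℝ f) := hf.continuous_fderiv one_ne_zero
  have hpt : ∀ y ∈ Q, ‖f x‖ₑ ≤ ‖f y‖ₑ + ENNReal.ofReal R *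
      ∫⁻ t in Set.Ioo (0:ℝ) 1, ‖fderiv ℝ f (x + t • (y - x))‖ₑ := by
    intro y hy
    have hd : ∀ t ∈ Set.uIcc (0:ℝ) 1, HasDerivAt (fun t : ℝ => f (x + t • (y - x)))
        (fderiv ℝ f (x + t • (y - x)) (y - x)) t := by
      intro t _
      have h1 : HasDerivAt (fun t : ℝ => x + t • (y - x)) (y - x) t := by
        simpa using ((hasDerivAt_id t).smul_const (y - x)).const_add x
      exact ((hf.differentiable one_ne_zero _).hasFDerivAt).comp_hasDerivAt t h1
    have hc : Continuous fun t : ℝ => fderiv ℝ f (x + t • (y - x)) (y - x) := by fun_prop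
    have hi := intervalIntegral.integral_eq_sub_of_hasDerivAt hd (hc.intervalIntegrable 0 1)
    simp only [one_smul, zero_smul, add_zero, add_sub_cancel] at hi
    have hfx : f x = f y - ∫ t in (0:ℝ)..1, fderiv ℝ f (x + t • (y - x)) (y - x) := by
      rw [hi]; abel
    calc ‖f x‖ₑ ≤ ‖f y‖ₑ + ‖∫ t in (0:ℝ)..1, fderiv ℝ f (x + t • (y - x)) (y - x)‖ₑ := by
          conv_lhs => rw [hfx]
          exact enorm_sub_le
      _ ≤ _ := by
          gcongr
          rw [intervalIntegral.integral_of_le zero_le_one, integral_Ioc_eq_integral_Ioo]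
          refine (enorm_integral_le_lintegral_enorm _).trans ?_
          rw [← lintegral_const_mul' _ _ ENNReal.ofReal_ne_top]
          refine lintegral_mono fun t => ?_
          refine ((fderiv ℝ f (x + t • (y - x))).le_opENorm _).trans ?_
          rw [mul_comm]
          gcongr
          rw [← ofReal_norm]
          exact ENNReal.ofReal_le_ofReal (hR x hx y hy)
  have hmeas : Measurable (Function.uncurry fun (y : ℝ × ℝ × ℝ) (t : ℝ) =>
      ‖fderiv ℝ f (x + t • (y - x))‖ₑ) := by
    refine Continuous.measurable ?_
    unfold Function.uncurry
    fun_prop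
  calc ‖f x‖ₑ * volume Q = ∫⁻ y in Q, ‖f x‖ₑ := by simp
    _ ≤ ∫⁻ y in Q, (‖f y‖ₑ + ENNReal.ofReal R *
      ∫⁻ t in Set.Ioo (0:ℝ) 1, ‖fderiv ℝ f (x + t • (y - x))‖ₑ) :=
        setLIntegral_mono' hm hpt
    _ = _ := by
      rw [lintegral_add_left (by exact hf.continuous.enorm.measurable),
        lintegral_const_mul' _ _ ENNReal.ofReal_ne_top,
        lintegral_lintegral_swap hmeas.aemeasurable]

theorem enn_add_pow_le (a b : ENNReal) (n : ℕ) : (a + b) ^ n ≤ 2 ^ n * (a ^ n + b ^ n) := by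
  rcases le_total a b with h | h
  · calc (a + b) ^ n ≤ (b + b) ^ n := by gcongr
      _ = 2 ^ n * b ^ n := by rw [← two_mul, mul_pow]
      _ ≤ _ := by gcongr; exact le_add_self
  · calc (a + b) ^ n ≤ (a + a) ^ n := by gcongr
      _ = 2 ^ n * a ^ n := by rw [← two_mul, mul_pow]
      _ ≤ _ := by gcongr; exact le_self_add

/-- half-power times cube weight -/
theorem ofReal_split {t : ℝ} (ht : 0 < t) :
    ENNReal.ofReal (t ^ (5/2 : ℝ)) = ENNReal.ofReal (t ^ (-1/2 : ℝ)) * ENNReal.ofReal (t ^ 3) := by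
  rw [← ENNReal.ofReal_mul (Real.rpow_nonneg ht.le _), ← Real.rpow_natCast t 3, ← Real.rpow_add ht]
  norm_num

theorem measT {Q : Set (ℝ × ℝ × ℝ)} {g : ℝ × ℝ × ℝ → ENNReal} (hg : Measurable g) :
    Measurable fun p : (ℝ × ℝ × ℝ) × ℝ => ∫⁻ y in Q, g (p.1 + p.2 • (y - p.1)) := by
  refine Measurable.lintegral_prod_right' (f := fun q : ((ℝ × ℝ × ℝ) × ℝ) × (ℝ × ℝ × ℝ) =>
    g (q.1.1 + q.1.2 • (q.2 - q.1.1))) ?_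
  refine hg.comp (Continuous.measurable ?_)
  fun_prop

theorem morrey_kernel : ∃ c : ENNReal, c ≠ ⊤ ∧ ∀ (Q : Set (ℝ × ℝ × ℝ)), Convex ℝ Q →
    MeasurableSet Q → ∀ g : ℝ × ℝ × ℝ → ENNReal, Measurable g → ∀ x ∈ Q,
    (∫⁻ t in Set.Ioo (0:ℝ) 1, ∫⁻ y in Q, g (x + t • (y - x))) ^ 4 ≤
      c * (volume Q) ^ 3 * ∫⁻ y in Q, g y ^ 4 := by
  obtain ⟨c, hc, hw⟩ := weight4
  refine ⟨c * ∫⁻ t in Set.Ioo (0:ℝ) 1, ENNReal.ofReal (t ^ (-1/2 : ℝ)),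
    ENNReal.mul_ne_top hc (lint_rpow_fin _ (by norm_num)), ?_⟩
  intro Q hQ hm g hg x hx
  have hT : Measurable fun t : ℝ => ∫⁻ y in Q, g (x + t • (y - x)) :=
    (measT hg).comp (measurable_const.prodMk measurable_id)
  refine (hw _ hT).trans ?_
  have hb : ∀ t ∈ Set.Ioo (0:ℝ) 1,
      ENNReal.ofReal (t ^ (5/2 : ℝ)) * (∫⁻ y in Q, g (x + t • (y - x))) ^ 4 ≤
      ENNReal.ofReal (t ^ (-1/2 : ℝ)) * ((volume Q) ^ 3 * ∫⁻ y in Q, g y ^ 4) := by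
    intro t ht
    have hgt : Measurable fun y => g (x + t • (y - x)) :=
      hg.comp (Continuous.measurable (by fun_prop))
    have h1 := holder4_one (volume.restrict Q) hgt
    rw [Measure.restrict_apply_univ] at h1
    have h2 := lint_scale hQ hm (fun y => g y ^ 4) hx ht.1 ht.2.le
    rw [ofReal_split ht.1, mul_assoc]
    gcongr ENNReal.ofReal (t ^ (-1/2 : ℝ)) * ?_
    calc ENNReal.ofReal (t ^ 3) * (∫⁻ y in Q, g (x + t • (y - x))) ^ 4
        ≤ ENNReal.ofReal (t ^ 3) * (volume Q ^ 3 * ∫⁻ y in Q, g (x + t • (y - x)) ^ 4) := by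
          gcongr
      _ = volume Q ^ 3 * (ENNReal.ofReal (t ^ 3) * ∫⁻ y in Q, g (x + t • (y - x)) ^ 4) := by
          ring
      _ ≤ _ := by gcongr
  calc c * ∫⁻ t in Set.Ioo (0:ℝ) 1, ENNReal.ofReal (t ^ (5/2 : ℝ)) *
        (∫⁻ y in Q, g (x + t • (y - x))) ^ 4
      ≤ c * ∫⁻ t in Set.Ioo (0:ℝ) 1, ENNReal.ofReal (t ^ (-1/2 : ℝ)) *
        ((volume Q) ^ 3 * ∫⁻ y in Q, g y ^ 4) := by
        gcongr 1
        exact setLIntegral_mono' measurableSet_Ioo hb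
    _ = _ := by
        rw [lintegral_mul_const _ (by fun_prop)]
        ring

theorem L4_kernel : ∃ c : ENNReal, c ≠ ⊤ ∧ ∀ (Q : Set (ℝ × ℝ × ℝ)), Convex ℝ Q →
    MeasurableSet Q → ∀ g : ℝ × ℝ × ℝ → ENNReal, Measurable g →
    ∫⁻ x in Q, (∫⁻ t in Set.Ioo (0:ℝ) 1, ∫⁻ y in Q, g (x + t • (y - x))) ^ 4 ≤
      c * (volume Q) ^ 3 * (∫⁻ y in Q, g y ^ 2) ^ 2 := by
  obtain ⟨c, hc, hw⟩ := weight4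
  refine ⟨8 * (c * ∫⁻ t in Set.Ioo (0:ℝ) 1, ENNReal.ofReal (t ^ (-1/2 : ℝ))),
    ENNReal.mul_ne_top (by norm_num) (ENNReal.mul_ne_top hc (lint_rpow_fin _ (by norm_num))), ?_⟩
  intro Q hQ hm g hg
  have hT : Measurable fun p : (ℝ × ℝ × ℝ) × ℝ => ∫⁻ y in Q, g (p.1 + p.2 • (y - p.1)) := measT hg
  have hg2 : Measurable fun y => g y ^ 2 := by fun_prop
  have hH : Measurable fun p : (ℝ × ℝ × ℝ) × ℝ => ∫⁻ y in Q, g (p.1 + p.2 • (y - p.1)) ^ 2 :=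
    measT hg2
  have hpt : Measurable fun p : (ℝ × ℝ × ℝ) × ℝ => ENNReal.ofReal (p.2 ^ (5/2 : ℝ)) *
      (∫⁻ y in Q, g (p.1 + p.2 • (y - p.1))) ^ 4 :=
    Measurable.mul (by fun_prop) (hT.pow_const 4)
  set I2 := ∫⁻ y in Q, g y ^ 2 with hI2
  -- bound of the double integral
  have h8 : ∀ s : ℝ, 1/2 ≤ s → s ≤ 1 → ∀ x ∈ Q,
      ∫⁻ y in Q, g (x + s • (y - x)) ^ 2 ≤ 8 * I2 := by
    intro s hs hs1 x hx
    have h := lint_scale hQ hm (fun y => g y ^ 2) hx (by linarith : 0 < s) hs1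
    have h18 : (1:ENNReal) ≤ 8 * ENNReal.ofReal (s ^ 3) := by
      rw [show (8:ENNReal) = ENNReal.ofReal 8 by norm_num, ← ENNReal.ofReal_mul (by norm_num),
        ← ENNReal.ofReal_one]
      apply ENNReal.ofReal_le_ofReal
      have : (1/2:ℝ)^3 ≤ s^3 := by gcongr
      linarith
    calc ∫⁻ y in Q, g (x + s • (y - x)) ^ 2
        ≤ (8 * ENNReal.ofReal (s ^ 3)) * ∫⁻ y in Q, g (x + s • (y - x)) ^ 2 :=
          le_mul_of_one_le_left' h18
      _ ≤ 8 * I2 := by rw [mul_assoc]; gcongr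
  have hdouble : ∀ t ∈ Set.Ioo (0:ℝ) 1,
      ∫⁻ x in Q, ∫⁻ y in Q, g (x + t • (y - x)) ^ 2 ≤ 8 * volume Q * I2 := by
    intro t ht
    rcases le_total (1/2) t with h | h
    · refine (setLIntegral_mono' hm fun x hx => h8 t h ht.2.le x hx).trans (le_of_eq ?_)
      simp; ring
    · rw [lintegral_lintegral_swap]
      · refine (setLIntegral_mono' (g := fun _ => 8 * I2) hm fun y hy => ?_).trans (le_of_eq ?_)
        · have := h8 (1 - t) (by linarith) (by linarith [ht.1]) y hy
          refine le_trans (le_of_eq ?_) this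
          refine lintegral_congr fun x => ?_
          congr 2
          module
        · simp; ring
      · refine Measurable.aemeasurable ?_
        refine hg2.comp (f := fun p : (ℝ × ℝ × ℝ) × (ℝ × ℝ × ℝ) => p.1 + t • (p.2 - p.1)) ?_
        exact Continuous.measurable (by fun_prop)
  have hx4 : ∀ t ∈ Set.Ioo (0:ℝ) 1, ∀ x ∈ Q,
      ENNReal.ofReal (t ^ (5/2 : ℝ)) * (∫⁻ y in Q, g (x + t • (y - x))) ^ 4 ≤
      ENNReal.ofReal (t ^ (-1/2 : ℝ)) * (volume Q ^ 2 * I2) *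
        ∫⁻ y in Q, g (x + t • (y - x)) ^ 2 := by
    intro t ht x hx
    have hgt : Measurable fun y => g (x + t • (y - x)) :=
      hg.comp (Continuous.measurable (by fun_prop))
    have h1 := holder2_one (volume.restrict Q) hgt
    rw [Measure.restrict_apply_univ] at h1
    have h2 := lint_scale hQ hm (fun y => g y ^ 2) hx ht.1 ht.2.le
    rw [ofReal_split ht.1]
    set H := ∫⁻ y in Q, g (x + t • (y - x)) ^ 2
    set T := ∫⁻ y in Q, g (x + t • (y - x))
    calc ENNReal.ofReal (t ^ (-1/2 : ℝ)) * ENNReal.ofReal (t ^ 3) * T ^ 4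
        = ENNReal.ofReal (t ^ (-1/2 : ℝ)) * ENNReal.ofReal (t ^ 3) * (T ^ 2) ^ 2 := by ring
      _ ≤ ENNReal.ofReal (t ^ (-1/2 : ℝ)) * ENNReal.ofReal (t ^ 3) * (volume Q * H) ^ 2 := by
          gcongr
      _ = ENNReal.ofReal (t ^ (-1/2 : ℝ)) * (volume Q ^ 2 * (ENNReal.ofReal (t ^ 3) * H)) * H := by
          ring
      _ ≤ _ := by gcongr
  calc ∫⁻ x in Q, (∫⁻ t in Set.Ioo (0:ℝ) 1, ∫⁻ y in Q, g (x + t • (y - x))) ^ 4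
      ≤ ∫⁻ x in Q, c * ∫⁻ t in Set.Ioo (0:ℝ) 1, ENNReal.ofReal (t ^ (5/2 : ℝ)) *
          (∫⁻ y in Q, g (x + t • (y - x))) ^ 4 :=
        lintegral_mono fun x => hw _ (hT.comp (measurable_const.prodMk measurable_id))
    _ = c * ∫⁻ t in Set.Ioo (0:ℝ) 1, ∫⁻ x in Q, ENNReal.ofReal (t ^ (5/2 : ℝ)) *
          (∫⁻ y in Q, g (x + t • (y - x))) ^ 4 := by
        rw [lintegral_const_mul' _ _ hc, lintegral_lintegral_swap hpt.aemeasurable]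
    _ ≤ c * ∫⁻ t in Set.Ioo (0:ℝ) 1, ENNReal.ofReal (t ^ (-1/2 : ℝ)) *
          (8 * volume Q ^ 3 * I2 ^ 2) := by
        gcongr 1
        refine setLIntegral_mono' measurableSet_Ioo fun t ht => ?_
        refine (setLIntegral_mono' hm (hx4 t ht)).trans ?_
        have hHt : Measurable fun x : ℝ × ℝ × ℝ => ∫⁻ y in Q, g (x + t • (y - x)) ^ 2 :=
          hH.comp (measurable_id.prodMk measurable_const)
        rw [lintegral_const_mul _ hHt]
        refine (mul_le_mul_right (hdouble t ht) _).trans (le_of_eq ?_)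
        ring
    _ = _ := by
        rw [lintegral_mul_const _ (by fun_prop)]
        ring

theorem sob_L4 {Q : Set (ℝ × ℝ × ℝ)} (hQ : Convex ℝ Q) (hm : MeasurableSet Q) {R : ℝ}
    (hR : ∀ x ∈ Q, ∀ y ∈ Q, ‖y - x‖ ≤ R) (h0 : volume Q ≠ 0) (ht : volume Q ≠ ⊤) :
    ∃ C : ENNReal, C ≠ ⊤ ∧ ∀ (F : Type) [NormedAddCommGroup F] [NormedSpace ℝ F] [CompleteSpace F]
      (f : ℝ × ℝ × ℝ → F), ContDiff ℝ 1 f →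
      ∫⁻ x in Q, ‖f x‖ₑ ^ 4 ≤
        C * ((∫⁻ x in Q, ‖f x‖ₑ ^ 2) + ∫⁻ x in Q, ‖fderiv ℝ f x‖ₑ ^ 2) ^ 2 := by
  obtain ⟨c, hc, hk⟩ := L4_kernel
  refine ⟨(volume Q)⁻¹ ^ 4 * (2 ^ 4 * (volume Q ^ 3 +
      ENNReal.ofReal R ^ 4 * (c * volume Q ^ 3))), ?_, ?_⟩
  · finiteness [ENNReal.inv_ne_top.2 h0]
  intro F _ _ _ f hf
  have hfm : Measurable fun x => ‖f x‖ₑ := hf.continuous.enorm.measurable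
  have hgm : Measurable fun x => ‖fderiv ℝ f x‖ₑ :=
    (hf.continuous_fderiv one_ne_zero).enorm.measurable
  set A := ∫⁻ x in Q, ‖f x‖ₑ ^ 2
  set B := ∫⁻ x in Q, ‖fderiv ℝ f x‖ₑ ^ 2
  set K : ℝ × ℝ × ℝ → ENNReal := fun x =>
    ∫⁻ t in Set.Ioo (0:ℝ) 1, ∫⁻ y in Q, ‖fderiv ℝ f (x + t • (y - x))‖ₑ with hK
  have hKi : ∫⁻ x in Q, K x ^ 4 ≤ c * volume Q ^ 3 * B ^ 2 := hk Q hQ hm _ hgm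
  have h1 : (∫⁻ y in Q, ‖f y‖ₑ) ^ 4 ≤ volume Q ^ 2 * A ^ 2 := by
    have := holder2_one (volume.restrict Q) hfm
    rw [Measure.restrict_apply_univ] at this
    calc (∫⁻ y in Q, ‖f y‖ₑ) ^ 4 = ((∫⁻ y in Q, ‖f y‖ₑ) ^ 2) ^ 2 := by ring
      _ ≤ (volume Q * A) ^ 2 := by gcongr
      _ = _ := by ring
  have hpt : ∀ x ∈ Q, ‖f x‖ₑ ^ 4 ≤ (volume Q)⁻¹ ^ 4 * (2 ^ 4 * (volume Q ^ 2 * A ^ 2 +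
      ENNReal.ofReal R ^ 4 * K x ^ 4)) := by
    intro x hx
    have h2 := repr_bound hm hR hf hx
    calc ‖f x‖ₑ ^ 4 = (volume Q)⁻¹ ^ 4 * (‖f x‖ₑ * volume Q) ^ 4 := by
          rw [← mul_pow, mul_comm ‖f x‖ₑ, ← mul_assoc, ENNReal.inv_mul_cancel h0 ht, one_mul]
      _ ≤ (volume Q)⁻¹ ^ 4 * ((∫⁻ y in Q, ‖f y‖ₑ) + ENNReal.ofReal R * K x) ^ 4 := by gcongr
      _ ≤ (volume Q)⁻¹ ^ 4 * (2 ^ 4 * ((∫⁻ y in Q, ‖f y‖ₑ) ^ 4 +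
            (ENNReal.ofReal R * K x) ^ 4)) := by
          gcongr
          exact enn_add_pow_le _ _ 4
      _ ≤ _ := by
          rw [mul_pow (ENNReal.ofReal R)]
          gcongr
  calc ∫⁻ x in Q, ‖f x‖ₑ ^ 4 ≤ ∫⁻ x in Q, (volume Q)⁻¹ ^ 4 * (2 ^ 4 * (volume Q ^ 2 * A ^ 2 +
      ENNReal.ofReal R ^ 4 * K x ^ 4)) := setLIntegral_mono' hm hpt
    _ = (volume Q)⁻¹ ^ 4 * (2 ^ 4 * (volume Q ^ 3 * A ^ 2 +
      ENNReal.ofReal R ^ 4 * ∫⁻ x in Q, K x ^ 4)) := by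
        rw [lintegral_const_mul' _ _ (by finiteness [ENNReal.inv_ne_top.2 h0]),
          lintegral_const_mul' _ _ (by finiteness), lintegral_add_left (by fun_prop),
          lintegral_const_mul' (ENNReal.ofReal R ^ 4) _ (by finiteness)]
        simp only [lintegral_const, Measure.restrict_apply_univ]
        ring
    _ ≤ (volume Q)⁻¹ ^ 4 * (2 ^ 4 * (volume Q ^ 3 * (A + B) ^ 2 +
      ENNReal.ofReal R ^ 4 * (c * volume Q ^ 3 * (A + B) ^ 2))) := by
        gcongr
        · exact le_self_add
        · refine hKi.trans ?_
          gcongr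
          exact le_add_self
    _ = _ := by ring

theorem sob_sup {Q : Set (ℝ × ℝ × ℝ)} (hQ : Convex ℝ Q) (hm : MeasurableSet Q) {R : ℝ}
    (hR : ∀ x ∈ Q, ∀ y ∈ Q, ‖y - x‖ ≤ R) (h0 : volume Q ≠ 0) (ht : volume Q ≠ ⊤) :
    ∃ C : ENNReal, C ≠ ⊤ ∧ ∀ (F : Type) [NormedAddCommGroup F] [NormedSpace ℝ F] [CompleteSpace F]
      (f : ℝ × ℝ × ℝ → F), ContDiff ℝ 1 f → ∀ x ∈ Q,
      ‖f x‖ₑ ^ 4 ≤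
        C * ((∫⁻ x in Q, ‖f x‖ₑ ^ 2) ^ 2 + ∫⁻ x in Q, ‖fderiv ℝ f x‖ₑ ^ 4) := by
  obtain ⟨c, hc, hk⟩ := morrey_kernel
  refine ⟨(volume Q)⁻¹ ^ 4 * (2 ^ 4 * (volume Q ^ 2 +
      ENNReal.ofReal R ^ 4 * (c * volume Q ^ 3))), ?_, ?_⟩
  · finiteness [ENNReal.inv_ne_top.2 h0]
  intro F _ _ _ f hf x hx
  have hfm : Measurable fun x => ‖f x‖ₑ := hf.continuous.enorm.measurable
  have hgm : Measurable fun x => ‖fderiv ℝ f x‖ₑ :=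
    (hf.continuous_fderiv one_ne_zero).enorm.measurable
  set A := ∫⁻ x in Q, ‖f x‖ₑ ^ 2
  set B := ∫⁻ x in Q, ‖fderiv ℝ f x‖ₑ ^ 4
  set K : ENNReal :=
    ∫⁻ t in Set.Ioo (0:ℝ) 1, ∫⁻ y in Q, ‖fderiv ℝ f (x + t • (y - x))‖ₑ with hK
  have hKi : K ^ 4 ≤ c * volume Q ^ 3 * B := hk Q hQ hm _ hgm x hx
  have h1 : (∫⁻ y in Q, ‖f y‖ₑ) ^ 4 ≤ volume Q ^ 2 * A ^ 2 := by
    have := holder2_one (volume.restrict Q) hfm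
    rw [Measure.restrict_apply_univ] at this
    calc (∫⁻ y in Q, ‖f y‖ₑ) ^ 4 = ((∫⁻ y in Q, ‖f y‖ₑ) ^ 2) ^ 2 := by ring
      _ ≤ (volume Q * A) ^ 2 := by gcongr
      _ = _ := by ring
  have h2 := repr_bound hm hR hf hx
  calc ‖f x‖ₑ ^ 4 = (volume Q)⁻¹ ^ 4 * (‖f x‖ₑ * volume Q) ^ 4 := by
        rw [← mul_pow, mul_comm ‖f x‖ₑ, ← mul_assoc, ENNReal.inv_mul_cancel h0 ht, one_mul]
    _ ≤ (volume Q)⁻¹ ^ 4 * ((∫⁻ y in Q, ‖f y‖ₑ) + ENNReal.ofReal R * K) ^ 4 := by gcongr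
    _ ≤ (volume Q)⁻¹ ^ 4 * (2 ^ 4 * ((∫⁻ y in Q, ‖f y‖ₑ) ^ 4 +
          (ENNReal.ofReal R * K) ^ 4)) := by
        gcongr
        exact enn_add_pow_le _ _ 4
    _ ≤ (volume Q)⁻¹ ^ 4 * (2 ^ 4 * (volume Q ^ 2 * (A ^ 2 + B) +
      ENNReal.ofReal R ^ 4 * (c * volume Q ^ 3 * (A ^ 2 + B)))) := by
        rw [mul_pow (ENNReal.ofReal R)]
        gcongr
        · refine h1.trans ?_
          gcongr
          exact le_self_add
        · refine hKi.trans ?_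
          gcongr
          exact le_add_self
    _ = _ := by ring

/-- Squared Sobolev norm as an extended nonnegative real. -/
noncomputable def sobX (L h : ℝ) (j : ℕ) (v : ℝ × ℝ × ℝ → ℝ × ℝ) : ENNReal :=
  ∑ i ∈ Finset.range (j + 1), ∫⁻ ζ in torusBox L h, ‖iteratedFDeriv ℝ i v ζ‖ₑ ^ 2

theorem le_sobX (L h : ℝ) {i j : ℕ} (hij : i ≤ j) (v : ℝ × ℝ × ℝ → ℝ × ℝ) :
    ∫⁻ ζ in torusBox L h, ‖iteratedFDeriv ℝ i v ζ‖ₑ ^ 2 ≤ sobX L h j v :=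
  Finset.single_le_sum (f := fun i => ∫⁻ ζ in torusBox L h, ‖iteratedFDeriv ℝ i v ζ‖ₑ ^ 2)
    (fun _ _ => zero_le) (Finset.mem_range.2 (by omega))

theorem box_facts (L h : ℝ) (hL : 0 < L) (hh : 0 < h) :
    Convex ℝ (torusBox L h) ∧ IsCompact (torusBox L h) ∧ volume (torusBox L h) ≠ 0 ∧
    volume (torusBox L h) ≠ ⊤ := by
  have hcomp : IsCompact (torusBox L h) := isCompact_Icc.prod (isCompact_Icc.prod isCompact_Icc)
  refine ⟨(convex_Icc _ _).prod ((convex_Icc _ _).prod (convex_Icc _ _)), hcomp, ?_, ?_⟩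
  · unfold torusBox
    rw [Measure.volume_eq_prod, Measure.prod_prod, Measure.volume_eq_prod, Measure.prod_prod]
    simp [hL, hh]
  · have := volHaar
    exact hcomp.measure_ne_top

theorem enorm_fderiv_iter {F : Type*} [NormedAddCommGroup F] [NormedSpace ℝ F]
    (f : ℝ × ℝ × ℝ → F) (x : ℝ × ℝ × ℝ) (n : ℕ) :
    ‖fderiv ℝ (iteratedFDeriv ℝ n f) x‖ₑ = ‖iteratedFDeriv ℝ (n + 1) f x‖ₑ := by
  rw [← ofReal_norm, ← ofReal_norm, norm_fderiv_iteratedFDeriv]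

theorem sob_embed (L h : ℝ) (hL : 0 < L) (hh : 0 < h) :
    ∃ C : ENNReal, C ≠ ⊤ ∧ ∀ v : ℝ × ℝ × ℝ → ℝ × ℝ, ContDiff ℝ (⊤ : ℕ∞) v →
      (∀ i j : ℕ, i + 1 ≤ j → ∫⁻ ζ in torusBox L h, ‖iteratedFDeriv ℝ i v ζ‖ₑ ^ 4 ≤
        (C * sobX L h j v) ^ 2) ∧
      (∀ i j : ℕ, i + 2 ≤ j → ∀ ζ ∈ torusBox L h, ‖iteratedFDeriv ℝ i v ζ‖ₑ ^ 2 ≤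
        C * sobX L h j v) := by
  obtain ⟨hconv, hcomp, h0, ht⟩ := box_facts L h hL hh
  have hm := hcomp.measurableSet
  obtain ⟨R, hR⟩ : ∃ R, ∀ x ∈ torusBox L h, ∀ y ∈ torusBox L h, ‖y - x‖ ≤ R := by
    obtain ⟨R, hR⟩ := (Metric.isBounded_iff.1 hcomp.isBounded)
    exact ⟨R, fun x hx y hy => by simpa [dist_eq_norm] using hR hy hx⟩
  obtain ⟨C1, hC1, h1⟩ := sob_L4 hconv hm hR h0 ht
  obtain ⟨C2, hC2, h2⟩ := sob_sup hconv hm hR h0 ht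
  have key : ∀ v : ℝ × ℝ × ℝ → ℝ × ℝ, ContDiff ℝ (⊤ : ℕ∞) v → ∀ i j : ℕ, i + 1 ≤ j →
      ∫⁻ ζ in torusBox L h, ‖iteratedFDeriv ℝ i v ζ‖ₑ ^ 4 ≤ 4 * C1 * sobX L h j v ^ 2 := by
    intro v hv i j hij
    have hc : ContDiff ℝ 1 (iteratedFDeriv ℝ i v) :=
      hv.iteratedFDeriv_right (by exact_mod_cast le_top)
    refine (h1 _ _ hc).trans ?_
    simp only [enorm_fderiv_iter]
    calc _ ≤ C1 * (sobX L h j v + sobX L h j v) ^ 2 := by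
          gcongr
          · exact le_sobX L h (by omega) v
          · exact le_sobX L h (by omega) v
      _ = _ := by ring
  refine ⟨1 + 4 * C1 + C2 * (1 + 4 * C1), by finiteness, fun v hv => ⟨?_, ?_⟩⟩
  · intro i j hij
    refine (key v hv i j hij).trans ?_
    rw [mul_pow]
    gcongr
    calc 4 * C1 ≤ (1 + 4 * C1 + C2 * (1 + 4 * C1)) := by
          rw [add_right_comm]; exact le_add_self
      _ ≤ _ := le_self_pow (by rw [add_assoc]; exact le_self_add) two_ne_zero
  · intro i j hij ζ hζ
    have hc : ContDiff ℝ 1 (iteratedFDeriv ℝ i v) :=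
      hv.iteratedFDeriv_right (by exact_mod_cast le_top)
    have h3 := h2 _ _ hc ζ hζ
    simp only [enorm_fderiv_iter] at h3
    refine (ENNReal.pow_le_pow_left_iff two_ne_zero).1 ?_
    calc (‖iteratedFDeriv ℝ i v ζ‖ₑ ^ 2) ^ 2 = ‖iteratedFDeriv ℝ i v ζ‖ₑ ^ 4 := by ring
      _ ≤ _ := h3
      _ ≤ C2 * (sobX L h j v ^ 2 + 4 * C1 * sobX L h j v ^ 2) := by
          gcongr
          · exact le_sobX L h (by omega) v
          · exact key v hv (i+1) j hij
      _ = C2 * (1 + 4 * C1) * sobX L h j v ^ 2 := by ring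
      _ ≤ _ := by
          rw [mul_pow]
          gcongr
          calc C2 * (1 + 4 * C1) ≤ (1 + 4 * C1 + C2 * (1 + 4 * C1)) := le_add_self
            _ ≤ _ := le_self_pow (by rw [add_assoc]; exact le_self_add) two_ne_zero

/-- Vertical integral over the whole fibre. -/
noncomputable def vertM (h : ℝ) (g : ℝ × ℝ × ℝ → ENNReal) (ζ : ℝ × ℝ × ℝ) : ENNReal :=
  ∫⁻ ξ in Set.Icc (-h) (0:ℝ), g (ζ.1, ζ.2.1, ξ)

theorem vertM_meas (h : ℝ) {g : ℝ × ℝ × ℝ → ENNReal} (hg : Measurable g) :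
    Measurable (vertM h g) := by
  refine Measurable.lintegral_prod_right' (f := fun q : (ℝ × ℝ × ℝ) × ℝ =>
    g (q.1.1, q.1.2.1, q.2)) ?_
  exact hg.comp (Continuous.measurable (by fun_prop))

theorem vertM_int (L h : ℝ) {g : ℝ × ℝ × ℝ → ENNReal} (hg : Measurable g) :
    ∫⁻ ζ in torusBox L h, vertM h g ζ = ENNReal.ofReal h * ∫⁻ ζ in torusBox L h, g ζ := by
  have hres : (volume : Measure (ℝ × ℝ × ℝ)).restrict (torusBox L h) =
      (volume.restrict (Set.Icc (0:ℝ) L)).prod ((volume.restrict (Set.Icc (0:ℝ) L)).prod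
        (volume.restrict (Set.Icc (-h) (0:ℝ)))) := by
    rw [Measure.prod_restrict, Measure.prod_restrict]
    rfl
  have hsplit : ∀ G : ℝ × ℝ × ℝ → ENNReal, Measurable G → ∫⁻ ζ in torusBox L h, G ζ =
      ∫⁻ x in Set.Icc (0:ℝ) L, ∫⁻ y in Set.Icc (0:ℝ) L, ∫⁻ z in Set.Icc (-h) (0:ℝ),
        G (x, y, z) := by
    intro G hG
    rw [hres, lintegral_prod _ hG.aemeasurable]
    refine lintegral_congr fun x => ?_
    exact lintegral_prod (fun p => G (x, p)) (hG.comp measurable_prodMk_left).aemeasurable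
  rw [hsplit _ (vertM_meas h hg), hsplit _ hg, ← lintegral_const_mul' _ _ ENNReal.ofReal_ne_top]
  refine lintegral_congr fun x => ?_
  rw [← lintegral_const_mul' _ _ ENNReal.ofReal_ne_top]
  refine lintegral_congr fun y => ?_
  simp [vertM, mul_comm]

theorem vertM_pow4 (L h : ℝ) {g : ℝ × ℝ × ℝ → ENNReal} (hg : Measurable g) :
    ∫⁻ ζ in torusBox L h, vertM h g ζ ^ 4 ≤
      ENNReal.ofReal h ^ 4 * ∫⁻ ζ in torusBox L h, g ζ ^ 4 := by
  have hpt : ∀ ζ, vertM h g ζ ^ 4 ≤ ENNReal.ofReal h ^ 3 * vertM h (fun y => g y ^ 4) ζ := by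
    intro ζ
    have hgz : Measurable fun ξ : ℝ => g (ζ.1, ζ.2.1, ξ) :=
      hg.comp (Continuous.measurable (by fun_prop))
    have := holder4_one (volume.restrict (Set.Icc (-h) (0:ℝ))) hgz
    simpa [vertM] using this
  refine (lintegral_mono hpt).trans ?_
  rw [lintegral_const_mul' _ _ (by finiteness), vertM_int L h (by fun_prop)]
  exact le_of_eq (by ring)

theorem vertM_pow2 (L h : ℝ) {g : ℝ × ℝ × ℝ → ENNReal} (hg : Measurable g) :
    ∫⁻ ζ in torusBox L h, vertM h g ζ ^ 2 ≤
      ENNReal.ofReal h ^ 2 * ∫⁻ ζ in torusBox L h, g ζ ^ 2 := by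
  have hpt : ∀ ζ, vertM h g ζ ^ 2 ≤ ENNReal.ofReal h * vertM h (fun y => g y ^ 2) ζ := by
    intro ζ
    have hgz : Measurable fun ξ : ℝ => g (ζ.1, ζ.2.1, ξ) :=
      hg.comp (Continuous.measurable (by fun_prop))
    have := holder2_one (volume.restrict (Set.Icc (-h) (0:ℝ))) hgz
    simpa [vertM] using this
  refine (lintegral_mono hpt).trans ?_
  rw [lintegral_const_mul' _ _ (by finiteness), vertM_int L h (by fun_prop)]
  exact le_of_eq (by ring)

theorem vertM_sup (L h : ℝ) {g : ℝ × ℝ × ℝ → ENNReal} {S : ENNReal}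
    (hS : ∀ ζ ∈ torusBox L h, g ζ ≤ S) {ζ : ℝ × ℝ × ℝ} (hζ : ζ ∈ torusBox L h) :
    vertM h g ζ ≤ ENNReal.ofReal h * S := by
  unfold vertM
  calc ∫⁻ ξ in Set.Icc (-h) (0:ℝ), g (ζ.1, ζ.2.1, ξ) ≤ ∫⁻ ξ in Set.Icc (-h) (0:ℝ), S :=
        setLIntegral_mono' measurableSet_Icc fun ξ hξ => hS _ ⟨hζ.1, hζ.2.1, hξ⟩
    _ = _ := by simp [mul_comm]

/-- differentiability of an average -/
theorem avg_hasFDerivAt (h : ℝ) {d : ℝ × ℝ × ℝ → ℝ} (hd : ContDiff ℝ 1 d) (ζ : ℝ × ℝ × ℝ) :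
    ∃ A : ℝ → (ℝ × ℝ × ℝ →L[ℝ] ℝ), Continuous A ∧
      (∀ s a b, A s (a, b, 0) = fderiv ℝ d (ζ.1, ζ.2.1, -h + (ζ.2.2 + h) * s) (a, b, 0)) ∧
      HasFDerivAt (fun ζ : ℝ × ℝ × ℝ => ∫ s in (0:ℝ)..1, d (ζ.1, ζ.2.1, -h + (ζ.2.2 + h) * s))
        (∫ s in (0:ℝ)..1, A s) ζ := by
  have hcd : Continuous (fderiv ℝ d) := hd.continuous_fderiv one_ne_zero
  -- the linear part of the parametrisation
  let P : ℝ → (ℝ × ℝ × ℝ →L[ℝ] ℝ × ℝ × ℝ) := fun s =>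
    ContinuousLinearMap.prod (ContinuousLinearMap.fst ℝ ℝ (ℝ × ℝ))
      (ContinuousLinearMap.prod ((ContinuousLinearMap.fst ℝ ℝ ℝ).comp
          (ContinuousLinearMap.snd ℝ ℝ (ℝ × ℝ)))
        (s • ((ContinuousLinearMap.snd ℝ ℝ ℝ).comp (ContinuousLinearMap.snd ℝ ℝ (ℝ × ℝ)))))
  have hPc : Continuous P := by
    have : ∀ s, P s = P 0 + s • (P 1 - P 0) := by
      intro s
      ext <;> simp [P]
    rw [show P = fun s => P 0 + s • (P 1 - P 0) from funext this]
    fun_prop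
  let F' : ℝ × ℝ × ℝ → ℝ → (ℝ × ℝ × ℝ →L[ℝ] ℝ) := fun ζ s =>
    (fderiv ℝ d (ζ.1, ζ.2.1, -h + (ζ.2.2 + h) * s)).comp (P s)
  have hF'c : Continuous (Function.uncurry F') := by
    unfold F' Function.uncurry
    exact (hcd.comp (by fun_prop)).clm_comp (hPc.comp continuous_snd)
  have hF's : ∀ ζ, Continuous (F' ζ) := fun ζ => hF'c.comp (by fun_prop : Continuous fun s => (ζ, s))
  have hder : ∀ s ζ, HasFDerivAt (fun ζ : ℝ × ℝ × ℝ => d (ζ.1, ζ.2.1, -h + (ζ.2.2 + h) * s))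
      (F' ζ s) ζ := by
    intro s ζ
    have h1 : HasFDerivAt (fun ζ : ℝ × ℝ × ℝ => (ζ.1, ζ.2.1, -h + (ζ.2.2 + h) * s)) (P s) ζ := by
      have h2 : (fun ζ : ℝ × ℝ × ℝ => (ζ.1, ζ.2.1, -h + (ζ.2.2 + h) * s)) =
          fun ζ => P s ζ + (0, 0, -h + h * s) := by
        funext ζ
        simp [P]
        ring
      rw [h2]
      exact (P s).hasFDerivAt.add_const _
    exact ((hd.differentiable one_ne_zero _).hasFDerivAt).comp ζ h1
  refine ⟨F' ζ, hF's ζ, ?_, ?_⟩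
  · intro s a b
    simp [F', P]
  · obtain ⟨C, hC⟩ := ((isCompact_closedBall ζ 1).prod (isCompact_Icc (a := (0:ℝ)) (b := 1))
      ).exists_bound_of_continuousOn hF'c.continuousOn
    refine intervalIntegral.hasFDerivAt_integral_of_dominated_of_fderiv_le
      (F' := F') (bound := fun _ => C)
      (Metric.closedBall_mem_nhds ζ one_pos) ?_ ?_ ?_ ?_ ?_ ?_
    · refine Filter.Eventually.of_forall fun x => ?_
      exact (hd.continuous.comp (by fun_prop)).aestronglyMeasurable
    · exact (hd.continuous.comp (by fun_prop)).intervalIntegrable _ _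
    · exact (hF's ζ).aestronglyMeasurable
    · refine Filter.Eventually.of_forall fun s hs x hx => ?_
      rw [Set.uIoc_of_le zero_le_one] at hs
      exact hC (x, s) ⟨hx, hs.1.le, hs.2⟩
    · exact intervalIntegrable_const
    · exact Filter.Eventually.of_forall fun s _ x _ => hder s x

theorem enorm_le_vertM {h : ℝ} (hh : 0 < h) {g : ℝ × ℝ × ℝ → ℝ} {ζ : ℝ × ℝ × ℝ}
    {r : ℝ} (hr : r ≤ ∫ ξ in (-h)..0, ‖g (ζ.1, ζ.2.1, ξ)‖) :
    ENNReal.ofReal r ≤ vertM h (fun ζ => ‖g ζ‖ₑ) ζ := by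
  refine (ENNReal.ofReal_le_ofReal hr).trans ((Real.ofReal_le_enorm _).trans ?_)
  rw [intervalIntegral.integral_of_le (by linarith), ← integral_Icc_eq_integral_Ioc]
  refine (enorm_integral_le_lintegral_enorm _).trans (le_of_eq ?_)
  simp [vertM]

theorem W_bound {h : ℝ} {d : ℝ × ℝ × ℝ → ℝ}
    {ζ : ℝ × ℝ × ℝ} (h1 : -h ≤ ζ.2.2) (h2 : ζ.2.2 ≤ 0) :
    ‖∫ ξ in (-h)..ζ.2.2, d (ζ.1, ζ.2.1, ξ)‖ₑ ≤ vertM h (fun ζ => ‖d ζ‖ₑ) ζ := by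
  rw [intervalIntegral.integral_of_le h1]
  refine (enorm_integral_le_lintegral_enorm _).trans ?_
  exact lintegral_mono_set fun ξ hξ => ⟨hξ.1.le, hξ.2.trans h2⟩

theorem W_deriv {h : ℝ} (hh : 0 < h) {d : ℝ × ℝ × ℝ → ℝ} (hd : ContDiff ℝ 1 d)
    {ζ : ℝ × ℝ × ℝ} (h1 : -h ≤ ζ.2.2) (h2 : ζ.2.2 ≤ 0) :
    DifferentiableAt ℝ (fun ζ : ℝ × ℝ × ℝ => ∫ ξ in (-h)..ζ.2.2, d (ζ.1, ζ.2.1, ξ)) ζ ∧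
    ‖fderiv ℝ (fun ζ : ℝ × ℝ × ℝ => ∫ ξ in (-h)..ζ.2.2, d (ζ.1, ζ.2.1, ξ)) ζ‖ₑ ≤
      ‖d ζ‖ₑ + vertM h (fun ζ => ‖fderiv ℝ d ζ‖ₑ) ζ := by
  have hcd : Continuous (fderiv ℝ d) := hd.continuous_fderiv one_ne_zero
  obtain ⟨A, hAc, hA, hI⟩ := avg_hasFDerivAt h hd ζ
  set W : ℝ × ℝ × ℝ → ℝ := fun ζ => ∫ ξ in (-h)..ζ.2.2, d (ζ.1, ζ.2.1, ξ) with hW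
  have hWeq : W = fun ζ : ℝ × ℝ × ℝ => (ζ.2.2 + h) *
      ∫ s in (0:ℝ)..1, d (ζ.1, ζ.2.1, -h + (ζ.2.2 + h) * s) := by
    funext ζ
    have := intervalIntegral.smul_integral_comp_add_mul (a := 0) (b := 1)
      (fun ξ => d (ζ.1, ζ.2.1, ξ)) (ζ.2.2 + h) (-h)
    simp only [smul_eq_mul, mul_zero, add_zero, mul_one, neg_add_cancel_comm_assoc] at this
    rw [this, hW]
  have hz : HasFDerivAt (fun ζ : ℝ × ℝ × ℝ => ζ.2.2 + h)
      ((ContinuousLinearMap.snd ℝ ℝ ℝ).comp (ContinuousLinearMap.snd ℝ ℝ (ℝ × ℝ))) ζ :=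
    (((ContinuousLinearMap.snd ℝ ℝ ℝ).comp
      (ContinuousLinearMap.snd ℝ ℝ (ℝ × ℝ))).hasFDerivAt).add_const h
  have hWd := hz.mul hI
  have hWd' := hWd.congr_of_eventuallyEq (f₁ := W) (Filter.EventuallyEq.of_eq hWeq)
  refine ⟨hWd'.differentiableAt, ?_⟩
  have hxy : ∀ a b, fderiv ℝ W ζ (a, b, 0) =
      ∫ ξ in (-h)..ζ.2.2, fderiv ℝ d (ζ.1, ζ.2.1, ξ) (a, b, 0) := by
    intro a b
    rw [hWd'.fderiv]
    have := intervalIntegral.smul_integral_comp_add_mul (a := 0) (b := 1)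
      (fun ξ => fderiv ℝ d (ζ.1, ζ.2.1, ξ) (a, b, 0)) (ζ.2.2 + h) (-h)
    simp only [smul_eq_mul, mul_zero, add_zero, mul_one, neg_add_cancel_comm_assoc] at this
    have h3 : (∫ s in (0:ℝ)..1, A s) (a, b, 0) = ∫ s in (0:ℝ)..1, A s (a, b, 0) :=
      ContinuousLinearMap.intervalIntegral_apply (hAc.intervalIntegrable _ _) _
    simp only [hA] at h3
    simp [h3]
    rw [this]
  have hdz : fderiv ℝ W ζ (0, 0, 1) = d ζ := by
    have hc : Continuous fun ξ : ℝ => d (ζ.1, ζ.2.1, ξ) := hd.continuous.comp (by fun_prop)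
    have e1 : HasDerivAt (fun z : ℝ => W (ζ.1, ζ.2.1, z)) (d (ζ.1, ζ.2.1, ζ.2.2)) ζ.2.2 :=
      intervalIntegral.integral_hasDerivAt_right (hc.intervalIntegrable _ _)
        (hc.stronglyMeasurableAtFilter _ _) hc.continuousAt
    have e2 : HasDerivAt (fun z : ℝ => ((ζ.1, ζ.2.1, z) : ℝ × ℝ × ℝ)) (0, 0, 1) ζ.2.2 :=
      (hasDerivAt_const _ _).prodMk ((hasDerivAt_const _ _).prodMk (hasDerivAt_id _))
    have e3 := (hWd'.differentiableAt.hasFDerivAt : HasFDerivAt W (fderiv ℝ W ζ)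
      (ζ.1, ζ.2.1, ζ.2.2)).comp_hasDerivAt ζ.2.2 e2
    exact e3.unique e1
  have hcn : Continuous fun ξ : ℝ => ‖fderiv ℝ d (ζ.1, ζ.2.1, ξ)‖ :=
    (hcd.comp (by fun_prop)).norm
  have hmain : ‖fderiv ℝ W ζ‖ ≤ ‖d ζ‖ + ∫ ξ in (-h)..0, ‖fderiv ℝ d (ζ.1, ζ.2.1, ξ)‖ := by
    have hnn : 0 ≤ ∫ ξ in (-h)..0, ‖fderiv ℝ d (ζ.1, ζ.2.1, ξ)‖ :=
      intervalIntegral.integral_nonneg (by linarith) fun _ _ => norm_nonneg _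
    refine ContinuousLinearMap.opNorm_le_bound _ (by positivity) ?_
    rintro ⟨a, b, c⟩
    have hdec : ((a, b, c) : ℝ × ℝ × ℝ) = c • (0, 0, 1) + (a, b, 0) := by simp
    have hab : ‖((a, b, 0) : ℝ × ℝ × ℝ)‖ ≤ ‖((a, b, c) : ℝ × ℝ × ℝ)‖ := by
      simp only [Prod.norm_mk, norm_zero]
      gcongr
      exact norm_nonneg c
    have hc' : ‖c‖ ≤ ‖((a, b, c) : ℝ × ℝ × ℝ)‖ := by
      simp [Prod.norm_mk]
    rw [hdec, map_add, map_smul, hdz, hxy, ← hdec]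
    refine (norm_add_le _ _).trans ?_
    rw [add_mul, norm_smul, mul_comm ‖c‖]
    gcongr
    rw [← intervalIntegral.integral_mul_const]
    calc ‖∫ ξ in (-h)..ζ.2.2, fderiv ℝ d (ζ.1, ζ.2.1, ξ) (a, b, 0)‖
        ≤ ∫ ξ in (-h)..ζ.2.2, ‖fderiv ℝ d (ζ.1, ζ.2.1, ξ)‖ * ‖((a, b, c) : ℝ × ℝ × ℝ)‖ := by
          refine intervalIntegral.norm_integral_le_of_norm_le h1 ?_
            ((hcn.mul continuous_const).intervalIntegrable _ _)
          refine Filter.Eventually.of_forall fun ξ _ => ?_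
          exact ((fderiv ℝ d _).le_opNorm _).trans (by gcongr)
      _ ≤ _ := by
          refine intervalIntegral.integral_mono_interval le_rfl h1 h2 ?_
            ((hcn.mul continuous_const).intervalIntegrable _ _)
          exact Filter.Eventually.of_forall fun ξ => by positivity
  rw [← ofReal_norm]
  refine (ENNReal.ofReal_le_ofReal hmain).trans (ENNReal.ofReal_add_le.trans ?_)
  rw [ofReal_norm]
  gcongr
  have := enorm_le_vertM hh (g := fun ζ => ‖fderiv ℝ d ζ‖) (ζ := ζ)
    (r := ∫ ξ in (-h)..0, ‖fderiv ℝ d (ζ.1, ζ.2.1, ξ)‖) (by simp)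
  simpa using this

theorem clm_enorm_add_le {F : Type*} [NormedAddCommGroup F] [NormedSpace ℝ F]
    (S T : ℝ × ℝ × ℝ →L[ℝ] F) : ‖S + T‖ₑ ≤ ‖S‖ₑ + ‖T‖ₑ := by
  simp only [← ofReal_norm]
  exact (ENNReal.ofReal_le_ofReal (norm_add_le S T)).trans ENNReal.ofReal_add_le

theorem clm_enorm_sub_le {F : Type*} [NormedAddCommGroup F] [NormedSpace ℝ F]
    (S T : ℝ × ℝ × ℝ →L[ℝ] F) : ‖S - T‖ₑ ≤ ‖S‖ₑ + ‖T‖ₑ := by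
  simp only [← ofReal_norm]
  exact (ENNReal.ofReal_le_ofReal (norm_sub_le S T)).trans ENNReal.ofReal_add_le

theorem clm_enorm_smul (c : ℝ) {F : Type*} [NormedAddCommGroup F] [NormedSpace ℝ F]
    (S : ℝ × ℝ × ℝ →L[ℝ] F) : ‖c • S‖ₑ = ‖c‖ₑ * ‖S‖ₑ := by
  simp only [← ofReal_norm]
  rw [norm_smul, ENNReal.ofReal_mul (norm_nonneg _)]

theorem lint_four {μ : Measure (ℝ × ℝ × ℝ)} {a b c d : ℝ × ℝ × ℝ → ENNReal} (ha : Measurable a)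
    (hb : Measurable b) (hc : Measurable c) :
    ∫⁻ ζ, 256 * ((a ζ ^ 2 + b ζ ^ 2) + (c ζ ^ 2 + d ζ ^ 2)) ∂μ =
    256 * ((∫⁻ ζ, a ζ ^ 2 ∂μ + ∫⁻ ζ, b ζ ^ 2 ∂μ) + (∫⁻ ζ, c ζ ^ 2 ∂μ + ∫⁻ ζ, d ζ ^ 2 ∂μ)) := by
  rw [lintegral_const_mul' _ _ (by norm_num),
    lintegral_add_left (f := fun ζ => a ζ ^ 2 + b ζ ^ 2) ((ha.pow_const 2).add (hb.pow_const 2)),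
    lintegral_add_left (ha.pow_const 2), lintegral_add_left (hc.pow_const 2)]

theorem sq_four (a b c d : ENNReal) :
    (4 * ((a + b) + (c + d))) ^ 2 ≤ 256 * ((a ^ 2 + b ^ 2) + (c ^ 2 + d ^ 2)) := by
  calc (4 * ((a + b) + (c + d))) ^ 2 = 16 * ((a + b) + (c + d)) ^ 2 := by ring
    _ ≤ 16 * (2 ^ 2 * ((a + b) ^ 2 + (c + d) ^ 2)) := by
        gcongr; exact enn_add_pow_le _ _ 2
    _ ≤ 16 * (2 ^ 2 * (2 ^ 2 * (a ^ 2 + b ^ 2) + 2 ^ 2 * (c ^ 2 + d ^ 2))) := by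
        gcongr
        · exact enn_add_pow_le _ _ 2
        · exact enn_add_pow_le _ _ 2
    _ = _ := by ring

theorem lint_four_bound {Q : Set (ℝ × ℝ × ℝ)} (hm : MeasurableSet Q)
    {f a b c d : ℝ × ℝ × ℝ → ENNReal} (ha : Measurable a)
    (hb : Measurable b) (hc : Measurable c)
    (hf : ∀ ζ ∈ Q, f ζ ≤ 4 * ((a ζ + b ζ) + (c ζ + d ζ))) :
    ∫⁻ ζ in Q, f ζ ^ 2 ≤ 256 * (((∫⁻ ζ in Q, a ζ ^ 2) + (∫⁻ ζ in Q, b ζ ^ 2)) +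
      ((∫⁻ ζ in Q, c ζ ^ 2) + (∫⁻ ζ in Q, d ζ ^ 2))) := by
  rw [← lint_four ha hb hc]
  exact setLIntegral_mono' hm fun ζ hζ => (pow_le_pow_left' (hf ζ hζ) 2).trans (sq_four _ _ _ _)

theorem comb_a {C H U2 U3 V2 J1 J2 J3 J4 T : ENNReal} (hu23 : U2 ≤ U3)
    (htot : T ≤ 256 * ((J1 + J2) + (J3 + J4)))
    (j1 : J1 ≤ C * U2 * V2) (j2 : J2 ≤ C * U2 * (C * V2))
    (j3a : J3 ≤ H ^ 2 * (C * U3) * V2) (j4a : J4 ≤ H ^ 2 * C * U3 * (C * V2)) :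
    T ≤ 256 * ((C + C * C) + ((H ^ 2 * C + H ^ 2 * C * C) + (H ^ 2 * C + H ^ 2 * C * C))) *
      (U3 * V2) := by
  refine htot.trans ?_
  calc 256 * ((J1 + J2) + (J3 + J4)) ≤ 256 * ((C * U3 * V2 + C * U3 * (C * V2)) +
          ((H ^ 2 * (C * U3) * V2 + H ^ 2 * C * C * (U3 * V2)) +
           (H ^ 2 * C * (U3 * V2) + H ^ 2 * C * U3 * (C * V2)))) := by
        gcongr
        · exact j1.trans (by gcongr)
        · exact j2.trans (by gcongr)
        · exact j3a.trans le_self_add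
        · exact j4a.trans le_add_self
    _ = _ := by ring

theorem comb_b {C H U2 V2 V3 J1 J2 J3 J4 T : ENNReal} (hv23 : V2 ≤ V3)
    (htot : T ≤ 256 * ((J1 + J2) + (J3 + J4)))
    (j1 : J1 ≤ C * U2 * V2) (j2 : J2 ≤ C * U2 * (C * V2))
    (j3b : J3 ≤ H ^ 2 * C * U2 * (C * V3)) (j4b : J4 ≤ C * V3 * (H ^ 2 * U2)) :
    T ≤ 256 * ((C + C * C) + ((H ^ 2 * C + H ^ 2 * C * C) + (H ^ 2 * C + H ^ 2 * C * C))) *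
      (U2 * V3) := by
  refine htot.trans ?_
  calc 256 * ((J1 + J2) + (J3 + J4)) ≤ 256 * ((C * U2 * V3 + C * U2 * (C * V3)) +
          ((H ^ 2 * C * (U2 * V3) + H ^ 2 * C * U2 * (C * V3)) +
           (C * V3 * (H ^ 2 * U2) + H ^ 2 * C * C * (U2 * V3)))) := by
        gcongr
        · exact j1.trans (by gcongr)
        · exact j2.trans (by gcongr)
        · exact j3b.trans le_add_self
        · exact j4b.trans le_self_add
    _ = _ := by ring

theorem smul_fderiv_bound {a : ℝ × ℝ × ℝ → ℝ} {w : ℝ × ℝ × ℝ → ℝ × ℝ} {ζ : ℝ × ℝ × ℝ}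
    (ha : DifferentiableAt ℝ a ζ) (hw : DifferentiableAt ℝ w ζ) :
    ‖fderiv ℝ (fun ζ => a ζ • w ζ) ζ‖ₑ ≤ ‖a ζ‖ₑ * ‖fderiv ℝ w ζ‖ₑ + ‖fderiv ℝ a ζ‖ₑ * ‖w ζ‖ₑ := by
  rw [fderiv_fun_smul ha hw]
  refine (clm_enorm_add_le _ _).trans ?_
  rw [clm_enorm_smul]
  gcongr
  simp only [← ofReal_norm, ContinuousLinearMap.norm_smulRight_apply,
    ENNReal.ofReal_mul (norm_nonneg _), le_refl]

theorem enorm_iter_one (f : ℝ × ℝ × ℝ → ℝ × ℝ) (ζ : ℝ × ℝ × ℝ) :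
    ‖fderiv ℝ f ζ‖ₑ = ‖iteratedFDeriv ℝ 1 f ζ‖ₑ := by
  rw [← ofReal_norm, ← ofReal_norm, norm_iteratedFDeriv_one]

theorem enorm_iter_zero (f : ℝ × ℝ × ℝ → ℝ × ℝ) (ζ : ℝ × ℝ × ℝ) :
    ‖f ζ‖ₑ = ‖iteratedFDeriv ℝ 0 f ζ‖ₑ := by
  rw [← ofReal_norm, ← ofReal_norm, norm_iteratedFDeriv_zero]

theorem enorm_iter_two (f : ℝ × ℝ × ℝ → ℝ × ℝ) (ζ : ℝ × ℝ × ℝ) :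
    ‖fderiv ℝ (fderiv ℝ f) ζ‖ₑ = ‖iteratedFDeriv ℝ 2 f ζ‖ₑ := by
  rw [← ofReal_norm, ← ofReal_norm, ← norm_iteratedFDeriv_fderiv, norm_iteratedFDeriv_one]

theorem enorm_clm_apply_le {F : Type*} [NormedAddCommGroup F] [NormedSpace ℝ F]
    (T : ℝ × ℝ × ℝ →L[ℝ] F) {e : ℝ × ℝ × ℝ} (he : ‖e‖ ≤ 1) : ‖T e‖ₑ ≤ ‖T‖ₑ := by
  refine (T.le_opENorm e).trans ?_
  refine mul_le_of_le_one_right' ?_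
  rw [← ofReal_norm]
  exact ENNReal.ofReal_le_one.2 he

theorem dir_bound {v : ℝ × ℝ × ℝ → ℝ × ℝ} (hv : ContDiff ℝ (⊤ : ℕ∞) v)
    {e : ℝ × ℝ × ℝ} (he : ‖e‖ ≤ 1) :
    ContDiff ℝ (⊤ : ℕ∞) (fun ζ => fderiv ℝ v ζ e) ∧ ∀ ζ,
    ‖fderiv ℝ v ζ e‖ₑ ≤ ‖iteratedFDeriv ℝ 1 v ζ‖ₑ ∧
    ‖fderiv ℝ (fun ζ => fderiv ℝ v ζ e) ζ‖ₑ ≤ ‖iteratedFDeriv ℝ 2 v ζ‖ₑ := by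
  have hv' : ContDiff ℝ (⊤ : ℕ∞) (fderiv ℝ v) := hv.fderiv_right (by simp)
  refine ⟨hv'.clm_apply contDiff_const, fun ζ => ⟨?_, ?_⟩⟩
  · rw [← enorm_iter_one]
    exact enorm_clm_apply_le _ he
  · rw [← enorm_iter_two]
    have hd : DifferentiableAt ℝ (fderiv ℝ v) ζ := hv'.differentiable (by simp) ζ
    have : fderiv ℝ (fun ζ => fderiv ℝ v ζ e) ζ = (fderiv ℝ (fderiv ℝ v) ζ).flip e := by
      rw [fderiv_clm_apply hd (differentiableAt_const e)]
      simp
    rw [this]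
    rw [← ofReal_norm, ← ofReal_norm]
    refine ENNReal.ofReal_le_ofReal ?_
    refine ((fderiv ℝ (fderiv ℝ v) ζ).flip.le_opNorm e).trans ?_
    rw [ContinuousLinearMap.opNorm_flip]
    exact mul_le_of_le_one_right (ContinuousLinearMap.opNorm_nonneg _) he

theorem fst_bound {w : ℝ × ℝ × ℝ → ℝ × ℝ} {ζ : ℝ × ℝ × ℝ} (hw : DifferentiableAt ℝ w ζ) :
    ‖fderiv ℝ (fun ζ => (w ζ).1) ζ‖ₑ ≤ ‖fderiv ℝ w ζ‖ₑ ∧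
    ‖fderiv ℝ (fun ζ => (w ζ).2) ζ‖ₑ ≤ ‖fderiv ℝ w ζ‖ₑ := by
  rw [hw.hasFDerivAt.fst.fderiv, hw.hasFDerivAt.snd.fderiv]
  simp only [← ofReal_norm]
  constructor <;> refine ENNReal.ofReal_le_ofReal ?_ <;>
    refine ContinuousLinearMap.opNorm_le_bound _ (norm_nonneg _) fun x => ?_
  · exact (norm_fst_le _).trans ((fderiv ℝ w ζ).le_opNorm x)
  · exact (norm_snd_le _).trans ((fderiv ℝ w ζ).le_opNorm x)

theorem enorm_fst_le' (p : ℝ × ℝ) : ‖p.1‖ₑ ≤ ‖p‖ₑ ∧ ‖p.2‖ₑ ≤ ‖p‖ₑ := by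
  simp only [← ofReal_norm]
  exact ⟨ENNReal.ofReal_le_ofReal (norm_fst_le p), ENNReal.ofReal_le_ofReal (norm_snd_le p)⟩

theorem div_bound {u : ℝ × ℝ × ℝ → ℝ × ℝ} (hu : ContDiff ℝ (⊤ : ℕ∞) u) :
    ContDiff ℝ 1 (div2' u) ∧ ∀ ζ, ‖div2' u ζ‖ₑ ≤ 2 * ‖iteratedFDeriv ℝ 1 u ζ‖ₑ ∧
      ‖fderiv ℝ (div2' u) ζ‖ₑ ≤ 2 * ‖iteratedFDeriv ℝ 2 u ζ‖ₑ := by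
  obtain ⟨c1, b1⟩ := dir_bound hu (e := (1, 0, 0)) (by simp [Prod.norm_mk])
  obtain ⟨c2, b2⟩ := dir_bound hu (e := (0, 1, 0)) (by simp [Prod.norm_mk])
  have hc : ContDiff ℝ (⊤ : ℕ∞) (div2' u) := c1.fst.add c2.snd
  refine ⟨hc.of_le (by exact_mod_cast le_top), fun ζ => ⟨?_, ?_⟩⟩
  · unfold div2'
    refine (enorm_add_le _ _).trans ?_
    rw [two_mul]
    exact add_le_add ((enorm_fst_le' _).1.trans (b1 ζ).1) ((enorm_fst_le' _).2.trans (b2 ζ).1)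
  · have d1 := c1.differentiable (by simp) ζ
    have d2 := c2.differentiable (by simp) ζ
    have : fderiv ℝ (div2' u) ζ = fderiv ℝ (fun ζ => (fderiv ℝ u ζ (1, 0, 0)).1) ζ +
        fderiv ℝ (fun ζ => (fderiv ℝ u ζ (0, 1, 0)).2) ζ := fderiv_fun_add d1.fst d2.snd
    rw [this]
    refine (clm_enorm_add_le _ _).trans ?_
    rw [two_mul]
    exact add_le_add ((fst_bound d1).1.trans (b1 ζ).2) ((fst_bound d2).2.trans (b2 ζ).2)

theorem vertM_two (h : ℝ) {f g : ℝ × ℝ × ℝ → ENNReal} (hfg : ∀ ζ, f ζ ≤ 2 * g ζ)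
    (ζ : ℝ × ℝ × ℝ) : vertM h f ζ ≤ 2 * vertM h g ζ := by
  unfold vertM
  rw [← lintegral_const_mul' _ _ (by norm_num)]
  exact lintegral_mono fun ξ => hfg _

theorem b_pointwise {L h : ℝ} (hh : 0 < h) {u v : ℝ × ℝ × ℝ → ℝ × ℝ}
    (hu : ContDiff ℝ (⊤ : ℕ∞) u) (hv : ContDiff ℝ (⊤ : ℕ∞) v) {ζ : ℝ × ℝ × ℝ}
    (hζ : ζ ∈ torusBox L h) :
    ‖fderiv ℝ (bPE' h u v) ζ‖ₑ ≤ 4 * (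
      (‖iteratedFDeriv ℝ 0 u ζ‖ₑ * ‖iteratedFDeriv ℝ 2 v ζ‖ₑ +
        ‖iteratedFDeriv ℝ 1 u ζ‖ₑ * ‖iteratedFDeriv ℝ 1 v ζ‖ₑ) +
      (vertM h (fun ζ => ‖iteratedFDeriv ℝ 1 u ζ‖ₑ) ζ * ‖iteratedFDeriv ℝ 2 v ζ‖ₑ +
        vertM h (fun ζ => ‖iteratedFDeriv ℝ 2 u ζ‖ₑ) ζ * ‖iteratedFDeriv ℝ 1 v ζ‖ₑ)) := by
  obtain ⟨c1, b1⟩ := dir_bound hv (e := (1, 0, 0)) (by simp [Prod.norm_mk])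
  obtain ⟨c2, b2⟩ := dir_bound hv (e := (0, 1, 0)) (by simp [Prod.norm_mk])
  obtain ⟨c3, b3⟩ := dir_bound hv (e := (0, 0, 1)) (by simp [Prod.norm_mk])
  obtain ⟨cd, bd⟩ := div_bound hu
  have hz1 : -h ≤ ζ.2.2 := hζ.2.2.1
  have hz2 : ζ.2.2 ≤ 0 := hζ.2.2.2
  obtain ⟨wd, wb⟩ := W_deriv hh cd hz1 hz2
  have w0 := W_bound (d := div2' u) hz1 hz2
  have d1 := c1.differentiable (by simp) ζ
  have d2 := c2.differentiable (by simp) ζ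
  have d3 := c3.differentiable (by simp) ζ
  have du := hu.differentiable (by simp) ζ
  have s1 := smul_fderiv_bound du.fst d1
  have s2 := smul_fderiv_bound du.snd d2
  have s3 := smul_fderiv_bound wd d3
  have hb : fderiv ℝ (bPE' h u v) ζ =
      fderiv ℝ (fun ζ => (u ζ).1 • fderiv ℝ v ζ (1, 0, 0)) ζ +
      fderiv ℝ (fun ζ => (u ζ).2 • fderiv ℝ v ζ (0, 1, 0)) ζ -
      fderiv ℝ (fun ζ => (∫ ξ in (-h)..ζ.2.2, div2' u (ζ.1, ζ.2.1, ξ)) •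
        fderiv ℝ v ζ (0, 0, 1)) ζ := by
    rw [← fderiv_fun_add (du.fst.fun_smul d1) (du.snd.fun_smul d2),
      ← fderiv_fun_sub ((du.fst.fun_smul d1).fun_add (du.snd.fun_smul d2)) (wd.fun_smul d3)]
    rfl
  have f1 := (fst_bound du)
  have m1 := vertM_two h (fun ζ => (bd ζ).1) ζ
  have m2 := vertM_two h (fun ζ => (bd ζ).2) ζ
  rw [enorm_iter_one] at f1
  have n0 := enorm_fst_le' (u ζ)
  rw [enorm_iter_zero] at n0
  rw [hb]
  have t1 := s1.trans (add_le_add (mul_le_mul' n0.1 (b1 ζ).2) (mul_le_mul' f1.1 (b1 ζ).1))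
  have t2 := s2.trans (add_le_add (mul_le_mul' n0.2 (b2 ζ).2) (mul_le_mul' f1.2 (b2 ζ).1))
  have t3 := s3.trans (add_le_add (mul_le_mul' (w0.trans m1) (b3 ζ).2)
    (mul_le_mul' (wb.trans (add_le_add (bd ζ).1 m2)) (b3 ζ).1))
  refine ((clm_enorm_sub_le _ _).trans (add_le_add ((clm_enorm_add_le _ _).trans (add_le_add t1 t2)) t3)).trans ?_
  generalize ‖iteratedFDeriv ℝ 0 u ζ‖ₑ = a0
  generalize ‖iteratedFDeriv ℝ 1 u ζ‖ₑ = a1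
  generalize ‖iteratedFDeriv ℝ 1 v ζ‖ₑ = p1
  generalize ‖iteratedFDeriv ℝ 2 v ζ‖ₑ = p2
  generalize vertM h (fun ζ => ‖iteratedFDeriv ℝ 1 u ζ‖ₑ) ζ = M1
  generalize vertM h (fun ζ => ‖iteratedFDeriv ℝ 2 u ζ‖ₑ) ζ = M2
  calc _ = 2 * (a0 * p2) + 4 * (a1 * p1) + 2 * (M1 * p2) + 2 * (M2 * p1) := by ring
    _ ≤ 4 * (a0 * p2) + 4 * (a1 * p1) + 4 * (M1 * p2) + 4 * (M2 * p1) := by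
        gcongr <;> norm_num
    _ = _ := by ring

theorem prod_L4 {L h : ℝ} {f g : ℝ × ℝ × ℝ → ENNReal} (hf : Measurable f) (hg : Measurable g)
    {A B : ENNReal} (hA : ∫⁻ ζ in torusBox L h, f ζ ^ 4 ≤ A ^ 2)
    (hB : ∫⁻ ζ in torusBox L h, g ζ ^ 4 ≤ B ^ 2) :
    ∫⁻ ζ in torusBox L h, (f ζ * g ζ) ^ 2 ≤ A * B := by
  refine (ENNReal.pow_le_pow_left_iff two_ne_zero).1 ?_
  have := holder2 (volume.restrict (torusBox L h)) (f := fun ζ => f ζ ^ 2) (g := fun ζ => g ζ ^ 2)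
    (by fun_prop) (by fun_prop)
  simp only [← mul_pow, ← pow_mul] at this
  norm_num at this
  refine this.trans ?_
  rw [mul_pow]
  gcongr

theorem prod_sup {L h : ℝ} (hm : MeasurableSet (torusBox L h)) {f g : ℝ × ℝ × ℝ → ENNReal}
    (hg : Measurable g)
    {A B : ENNReal} (hA : ∀ ζ ∈ torusBox L h, f ζ ^ 2 ≤ A)
    (hB : ∫⁻ ζ in torusBox L h, g ζ ^ 2 ≤ B) :
    ∫⁻ ζ in torusBox L h, (f ζ * g ζ) ^ 2 ≤ A * B := by
  calc ∫⁻ ζ in torusBox L h, (f ζ * g ζ) ^ 2 ≤ ∫⁻ ζ in torusBox L h, A * g ζ ^ 2 := by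
        refine setLIntegral_mono' hm fun ζ hζ => ?_
        rw [mul_pow]
        gcongr
        exact hA ζ hζ
    _ = A * ∫⁻ ζ in torusBox L h, g ζ ^ 2 := lintegral_const_mul _ (by fun_prop)
    _ ≤ _ := by gcongr

theorem sobX_mono (L h : ℝ) {i j : ℕ} (hij : i ≤ j) (v : ℝ × ℝ × ℝ → ℝ × ℝ) :
    sobX L h i v ≤ sobX L h j v :=
  Finset.sum_le_sum_of_subset (Finset.range_mono (by omega))

theorem main_enn (L h : ℝ) (hL : 0 < L) (hh : 0 < h) :
    ∃ K : ENNReal, K ≠ ⊤ ∧ ∀ u v : ℝ × ℝ × ℝ → ℝ × ℝ,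
      ContDiff ℝ (⊤ : ℕ∞) u → ContDiff ℝ (⊤ : ℕ∞) v →
      ∫⁻ ζ in torusBox L h, ‖fderiv ℝ (bPE' h u v) ζ‖ₑ ^ 2 ≤ K * (sobX L h 3 u * sobX L h 2 v) ∧
      ∫⁻ ζ in torusBox L h, ‖fderiv ℝ (bPE' h u v) ζ‖ₑ ^ 2 ≤ K * (sobX L h 2 u * sobX L h 3 v) := by
  obtain ⟨C, hC, hemb⟩ := sob_embed L h hL hh
  obtain ⟨-, hcomp, -, -⟩ := box_facts L h hL hh
  have hm := hcomp.measurableSet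
  obtain ⟨H, hH⟩ : ∃ H, H = ENNReal.ofReal h := ⟨_, rfl⟩
  have hHt : H ≠ ⊤ := hH ▸ ENNReal.ofReal_ne_top
  refine ⟨256 * ((C + C * C) + ((H ^ 2 * C + H ^ 2 * C * C) + (H ^ 2 * C + H ^ 2 * C * C))),
    by finiteness, fun u v hu hv => ?_⟩
  obtain ⟨u4, us⟩ := hemb u hu
  obtain ⟨v4, vs⟩ := hemb v hv
  have mu : ∀ i : ℕ, Measurable fun ζ => ‖iteratedFDeriv ℝ i u ζ‖ₑ := fun i =>
    (hu.continuous_iteratedFDeriv (by exact_mod_cast le_top)).enorm.measurable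
  have mv : ∀ i : ℕ, Measurable fun ζ => ‖iteratedFDeriv ℝ i v ζ‖ₑ := fun i =>
    (hv.continuous_iteratedFDeriv (by exact_mod_cast le_top)).enorm.measurable
  have mM : ∀ i : ℕ, Measurable (vertM h fun ζ => ‖iteratedFDeriv ℝ i u ζ‖ₑ) := fun i =>
    vertM_meas h (mu i)
  have M4 : ∀ i j, i + 1 ≤ j →
      ∫⁻ ζ in torusBox L h, vertM h (fun ζ => ‖iteratedFDeriv ℝ i u ζ‖ₑ) ζ ^ 4 ≤
      (H ^ 2 * C * sobX L h j u) ^ 2 := by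
    intro i j hij
    refine (vertM_pow4 L h (mu i)).trans ?_
    rw [← hH]
    calc _ ≤ H ^ 4 * (C * sobX L h j u) ^ 2 := by gcongr; exact u4 i j hij
      _ = _ := by ring
  have htot := lint_four_bound hm (f := fun ζ => ‖fderiv ℝ (bPE' h u v) ζ‖ₑ)
    ((mu 0).mul (mv 2)) ((mu 1).mul (mv 1)) ((mM 1).mul (mv 2))
    (fun ζ hζ => b_pointwise hh hu hv hζ)
  have j1 := prod_sup hm (mv 2) (us 0 2 le_rfl) (le_sobX L h le_rfl v)
  have j2 := prod_L4 (mu 1) (mv 1) (u4 1 2 le_rfl) (v4 1 2 le_rfl)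
  have hroot : ∀ ζ ∈ torusBox L h, ‖iteratedFDeriv ℝ 1 u ζ‖ₑ ≤
      (C * sobX L h 3 u) ^ (1/2 : ℝ) := by
    intro ζ hζ
    have h1 := us 1 3 le_rfl ζ hζ
    refine (ENNReal.pow_le_pow_left_iff two_ne_zero).1 (h1.trans (le_of_eq ?_))
    rw [← ENNReal.rpow_natCast ((C * sobX L h 3 u) ^ (1/2 : ℝ)), ← ENNReal.rpow_mul]
    norm_num
  have j3s : ∀ ζ ∈ torusBox L h, vertM h (fun ζ => ‖iteratedFDeriv ℝ 1 u ζ‖ₑ) ζ ^ 2 ≤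
      H ^ 2 * (C * sobX L h 3 u) := by
    intro ζ hζ
    refine (pow_le_pow_left' (vertM_sup L h hroot hζ) 2).trans (le_of_eq ?_)
    rw [← hH, mul_pow, ← ENNReal.rpow_natCast ((C * sobX L h 3 u) ^ (1/2 : ℝ)), ← ENNReal.rpow_mul]
    norm_num
  have j3a := prod_sup hm (mv 2) j3s (le_sobX L h le_rfl v)
  have j3b := prod_L4 (mM 1) (mv 2) (M4 1 2 le_rfl) (v4 2 3 le_rfl)
  have j4a := prod_L4 (mM 2) (mv 1) (M4 2 3 le_rfl) (v4 1 2 le_rfl)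
  have m2 : ∫⁻ ζ in torusBox L h, vertM h (fun ζ => ‖iteratedFDeriv ℝ 2 u ζ‖ₑ) ζ ^ 2 ≤
      H ^ 2 * sobX L h 2 u := by
    refine (vertM_pow2 L h (mu 2)).trans ?_
    rw [← hH]
    gcongr
    exact le_sobX L h le_rfl u
  have j4b := prod_sup hm (mM 2) (vs 1 3 le_rfl) m2
  simp only [mul_comm ‖iteratedFDeriv ℝ 1 v _‖ₑ] at j4b
  exact ⟨comb_a (sobX_mono L h (by norm_num) u) htot j1 j2 j3a j4a,
    comb_b (sobX_mono L h (by norm_num) v) htot j1 j2 j3b j4b⟩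

theorem int_sq_eq {F : Type*} [NormedAddCommGroup F] {f : ℝ × ℝ × ℝ → F} {Q : Set (ℝ × ℝ × ℝ)}
    (hf : Measurable fun ζ => ‖f ζ‖) :
    ∫ ζ in Q, ‖f ζ‖ ^ 2 = (∫⁻ ζ in Q, ‖f ζ‖ₑ ^ 2).toReal := by
  rw [integral_eq_lintegral_of_nonneg_ae (Filter.Eventually.of_forall fun ζ => by positivity)
    (hf.pow_const 2).aestronglyMeasurable]
  congr 1
  refine lintegral_congr fun ζ => ?_
  rw [ENNReal.ofReal_pow (norm_nonneg _), ofReal_norm]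

theorem sobX_fin (L h : ℝ) (hL : 0 < L) (hh : 0 < h) (j : ℕ) {v : ℝ × ℝ × ℝ → ℝ × ℝ}
    (hv : ContDiff ℝ (⊤ : ℕ∞) v) :
    sobX L h j v ≠ ⊤ ∧ sobNorm L h j v = (sobX L h j v).toReal ^ (1/2 : ℝ) := by
  obtain ⟨-, hcomp, -, -⟩ := box_facts L h hL hh
  have hc : ∀ i : ℕ, Continuous fun ζ => ‖iteratedFDeriv ℝ i v ζ‖ := fun i =>
    (hv.continuous_iteratedFDeriv (by exact_mod_cast le_top)).norm
  have := volHaar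
  have hfin : ∀ i : ℕ, ∫⁻ ζ in torusBox L h, ‖iteratedFDeriv ℝ i v ζ‖ₑ ^ 2 ≠ ⊤ := by
    intro i
    have h1 : IntegrableOn (fun ζ => ‖iteratedFDeriv ℝ i v ζ‖ ^ 2) (torusBox L h) :=
      ((hc i).pow 2).continuousOn.integrableOn_compact hcomp
    have h2 := h1.2
    rw [hasFiniteIntegral_iff_enorm] at h2
    simpa using h2.ne
  constructor
  · exact ENNReal.sum_ne_top.2 fun i _ => hfin i
  · unfold sobNorm sobX
    rw [ENNReal.toReal_sum fun i _ => hfin i]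
    congr 1
    exact Finset.sum_congr rfl fun i _ => int_sq_eq (hc i).measurable

/-- `‖∇b(u,v)‖_{L²} ≤ C min(‖u‖_{H³}‖v‖_{H²}, ‖u‖_{H²}‖v‖_{H³})`. -/
theorem grad_bPE_L2_estimate (L h : ℝ) (hL : 0 < L) (hh : 0 < h) :
    ∃ C > 0, ∀ u v : ℝ × ℝ × ℝ → ℝ × ℝ,
      ContDiff ℝ (⊤ : ℕ∞) u → ContDiff ℝ (⊤ : ℕ∞) v →
      torusPeriodic L h u → torusPeriodic L h v →
      l2Norm L h (fun ζ => fderiv ℝ (bPE' h u v) ζ)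
        ≤ C * min (sobNorm L h 3 u * sobNorm L h 2 v)
                  (sobNorm L h 2 u * sobNorm L h 3 v) := by

  obtain ⟨K, hK, hmain⟩ := main_enn L h hL hh
  refine ⟨K.toReal ^ (1/2 : ℝ) + 1, by positivity, fun u v hu hv _ _ => ?_⟩
  obtain ⟨b1, b2⟩ := hmain u v hu hv
  have key : ∀ X Y : ENNReal, X ≠ ⊤ → Y ≠ ⊤ →
      ∫⁻ ζ in torusBox L h, ‖fderiv ℝ (bPE' h u v) ζ‖ₑ ^ 2 ≤ K * (X * Y) →
      l2Norm L h (fun ζ => fderiv ℝ (bPE' h u v) ζ) ≤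
        (K.toReal ^ (1/2 : ℝ) + 1) * (X.toReal ^ (1/2 : ℝ) * Y.toReal ^ (1/2 : ℝ)) := by
    intro X Y hX hY hb
    unfold l2Norm
    rw [int_sq_eq (measurable_fderiv ℝ (bPE' h u v)).norm]
    calc _ ≤ ((K * (X * Y)).toReal) ^ (1/2 : ℝ) := by
          gcongr
          finiteness
      _ = K.toReal ^ (1/2 : ℝ) * (X.toReal ^ (1/2 : ℝ) * Y.toReal ^ (1/2 : ℝ)) := by
          rw [ENNReal.toReal_mul, ENNReal.toReal_mul, Real.mul_rpow (by positivity) (by positivity),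
            Real.mul_rpow (by positivity) (by positivity)]
      _ ≤ _ := by
          gcongr
          linarith
  obtain ⟨fu2, eu2⟩ := sobX_fin L h hL hh 2 hu
  obtain ⟨fu3, eu3⟩ := sobX_fin L h hL hh 3 hu
  obtain ⟨fv2, ev2⟩ := sobX_fin L h hL hh 2 hv
  obtain ⟨fv3, ev3⟩ := sobX_fin L h hL hh 3 hv
  rw [eu2, eu3, ev2, ev3, mul_min_of_nonneg _ _ (by positivity)]
  exact le_min (key _ _ fu3 fv2 b1) (key _ _ fu2 fv3 b2)
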